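/- Let G be a non-compact group equipped with a T0 Alexandroff topology making G a paratopological group (multiplication continuous). Then for every subset S ⊆ G, the set S⁻¹ = {s⁻¹ : s ∈ S} is open if and only if S is closed. (Equivalently, the conjugate (inverse) topology of G coincides with the opposite topology, whose open sets are the closed sets of G.) -/

import Mathlib

/-- Inversion in a group with jointly continuous multiplication reverses specialization. -/
theorem Specializes.inv_reverse {G : Type*} [Group G] [TopologicalSpace G] [ContinuousMul G]
    {x y : G} (h : x ⤳ y) : y⁻¹ ⤳ x⁻¹ := by
  have hmap := h.map (f := fun z => x⁻¹ * z * y⁻¹) (by fun_prop)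
  simpa using hmap

/-- In a non-compact Alexandroff paratopological group, the conjugate (inverse) topology
coincides with the opposite topology: for every subset `S`, the set of inverses `S⁻¹` is
open if and only if `S` is closed. -/
theorem isOpen_inv_iff_isClosed
    (G : Type*) [Group G] [TopologicalSpace G] [AlexandrovDiscrete G] [T0Space G]
    [ContinuousMul G] [NoncompactSpace G] (S : Set G) :
    IsOpen S⁻¹ ↔ IsClosed S := by
  rw [← isOpen_compl_iff, isOpen_iff_forall_specializes, isOpen_iff_forall_specializes]
  constructor
  · intro h x y hxy hy hx
    exact hy (by simpa using h _ _ hxy.inv_reverse (by simpa using hx))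
  · intro h x y hxy hy
    by_contra hx
    exact h _ _ hxy.inv_reverse hx hy
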